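/- Let P(λ) = Σ_{i=0}^k λ^i A_i be an m×n matrix polynomial of grade k with m ≥ n, and let L(λ) ∈ 𝕃₁(P) have nonzero right ansatz vector v ∈ F^k. Then for any nonsingular M ∈ F^{k×k} with Mv = αe₁ for some α ≠ 0, the pencil (M⊗I_m)L(λ) has the block form λ[[αA_k, X₁₂],[0, −Z]] + [[Y₁₁, αA₀],[Z, 0]] with Z ∈ F^{(k-1)m×(k-1)n}. If Z has full rank, i.e. rank Z = (k−1)n, then L(λ) is a strong g-linearization of P(λ). -/

import Mathlib

noncomputable section

open Polynomial Matrix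

namespace GLin

variable {F : Type*} [RCLike F]

/-! ### Matrix polynomials and pencils -/

/-- The matrix polynomial `P(λ) = ∑_{i=0}^k λ^i A_i` determined by its
coefficient matrices `A_0, …, A_k` (grade `k`). -/
def matPoly {k m n : ℕ} (A : Fin (k + 1) → Matrix (Fin m) (Fin n) F) :
    Matrix (Fin m) (Fin n) F[X] :=
  Matrix.of fun r c => ∑ i : Fin (k + 1), Polynomial.C (A i r c) * Polynomial.X ^ (i : ℕ)

/-- The matrix pencil `L(λ) = λ X + Y`. -/
def pencil {ρ γ : Type*} (Xc Yc : Matrix ρ γ F) : Matrix ρ γ F[X] :=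
  Matrix.of fun i j => Polynomial.C (Xc i j) * Polynomial.X + Polynomial.C (Yc i j)

/-- `Λ_k(λ) ⊗ I_n` where `Λ_k(λ) = (λ^{k-1}, …, λ, 1)ᵀ`. -/
def Lam (F : Type*) [RCLike F] (k n : ℕ) : Matrix (Fin k × Fin n) (Fin n) F[X] :=
  Matrix.of fun p c => if p.2 = c then Polynomial.X ^ (k - 1 - (p.1 : ℕ)) else 0

/-- `Λ_k(λ)ᵀ ⊗ I_m`. -/
def LamRow (F : Type*) [RCLike F] (k m : ℕ) : Matrix (Fin m) (Fin k × Fin m) F[X] :=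
  Matrix.of fun r p => if r = p.2 then Polynomial.X ^ (k - 1 - (p.1 : ℕ)) else 0

/-- `v ⊗ P(λ)`. -/
def vkron {k m n : ℕ} (v : Fin k → F) (P : Matrix (Fin m) (Fin n) F[X]) :
    Matrix (Fin k × Fin m) (Fin n) F[X] :=
  Matrix.of fun p c => Polynomial.C (v p.1) * P p.2 c

/-- `wᵀ ⊗ P(λ)`. -/
def wkron {k m n : ℕ} (w : Fin k → F) (P : Matrix (Fin m) (Fin n) F[X]) :
    Matrix (Fin m) (Fin k × Fin n) F[X] :=
  Matrix.of fun r q => Polynomial.C (w q.1) * P r q.2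

/-- The defining identity of `𝕃₁(P)`: `L(λ)(Λ_k(λ) ⊗ I_n) = v ⊗ P(λ)`. -/
def RightAnsatz {k m n : ℕ} (P : Matrix (Fin m) (Fin n) F[X])
    (L : Matrix (Fin k × Fin m) (Fin k × Fin n) F[X]) (v : Fin k → F) : Prop :=
  L * Lam F k n = vkron v P

/-- The defining identity of `𝕃₂(P)`: `(Λ_k(λ)ᵀ ⊗ I_m) L(λ) = wᵀ ⊗ P(λ)`. -/
def LeftAnsatz {k m n : ℕ} (P : Matrix (Fin m) (Fin n) F[X])
    (L : Matrix (Fin k × Fin m) (Fin k × Fin n) F[X]) (w : Fin k → F) : Prop :=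
  LamRow F k m * L = wkron w P

/-- The vector `α e₁ ∈ F^k`. -/
def e1 {k : ℕ} (α : F) : Fin k → F := fun i => if (i : ℕ) = 0 then α else 0

/-- `M ⊗ I_m`. -/
def kronId {k m : ℕ} (M : Matrix (Fin k) (Fin k) F) :
    Matrix (Fin k × Fin m) (Fin k × Fin m) F :=
  Matrix.of fun p q => if p.2 = q.2 then M p.1 q.1 else 0

/-! ### (strong) g-linearizations -/

/-- `diag(P(λ), I_{k-1} ⊗ I_{m,n})`. -/
def glinTarget {k m n : ℕ} (P : Matrix (Fin m) (Fin n) F[X]) :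
    Matrix (Fin k × Fin m) (Fin k × Fin n) F[X] :=
  Matrix.of fun p q =>
    if p.1 = q.1 then
      (if (p.1 : ℕ) = 0 then P p.2 q.2 else if (p.2 : ℕ) = (q.2 : ℕ) then 1 else 0)
    else 0

/-- A `km × kn` pencil (or matrix polynomial) `L` is a g-linearization of the `m × n`
matrix polynomial `P` of grade `k` if `E(λ) L(λ) G(λ) = diag(P(λ), I_{k-1} ⊗ I_{m,n})`
for unimodular `E`, `G`. -/
def IsGLin {k m n : ℕ} (P : Matrix (Fin m) (Fin n) F[X])
    (L : Matrix (Fin k × Fin m) (Fin k × Fin n) F[X]) : Prop :=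
  ∃ (E : Matrix (Fin k × Fin m) (Fin k × Fin m) F[X])
    (G : Matrix (Fin k × Fin n) (Fin k × Fin n) F[X]),
      IsUnit E.det ∧ IsUnit G.det ∧ E * L * G = glinTarget P

/-- grade-`N` reversal `rev_N P(λ) = λ^N P(1/λ)`, entrywise. -/
def revMat {ρ γ : Type*} (N : ℕ) (P : Matrix ρ γ F[X]) : Matrix ρ γ F[X] :=
  P.map fun p => Polynomial.reflect N p

/-- Strong g-linearization of the grade-`k` matrix polynomial with coefficients `A`. -/
def IsStrongGLin {k m n : ℕ} (A : Fin (k + 1) → Matrix (Fin m) (Fin n) F)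
    (L : Matrix (Fin k × Fin m) (Fin k × Fin n) F[X]) : Prop :=
  IsGLin (matPoly A) L ∧ IsGLin (revMat k (matPoly A)) (revMat 1 L)

/-! ### linearizations (rectangular, of size `(m+s) × (n+s)`) -/

/-- A matrix polynomial `L` (indexed by arbitrary finite types of cardinalities
`m + s` and `n + s`) is a linearization of `P` if, after identifying the index types
with `Fin m ⊕ Fin s` and `Fin n ⊕ Fin s`, one has `E(λ) L(λ) G(λ) = diag(P(λ), I_s)`
for unimodular `E`, `G`. -/
def IsLin {m n : ℕ} (s : ℕ) (P : Matrix (Fin m) (Fin n) F[X])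
    {ρ γ : Type*} [Fintype ρ] [DecidableEq ρ] [Fintype γ] [DecidableEq γ]
    (L : Matrix ρ γ F[X]) : Prop :=
  ∃ (er : ρ ≃ (Fin m ⊕ Fin s)) (ec : γ ≃ (Fin n ⊕ Fin s))
    (E : Matrix (Fin m ⊕ Fin s) (Fin m ⊕ Fin s) F[X])
    (G : Matrix (Fin n ⊕ Fin s) (Fin n ⊕ Fin s) F[X]),
      IsUnit E.det ∧ IsUnit G.det ∧
        E * Matrix.reindex er ec L * G = Matrix.fromBlocks P 0 0 1

/-- Strong linearization of the grade-`k` matrix polynomial with coefficients `A`. -/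
def IsStrongLin {k m n : ℕ} (s : ℕ) (A : Fin (k + 1) → Matrix (Fin m) (Fin n) F)
    {ρ γ : Type*} [Fintype ρ] [DecidableEq ρ] [Fintype γ] [DecidableEq γ]
    (L : Matrix ρ γ F[X]) : Prop :=
  IsLin s (matPoly A) L ∧ IsLin s (revMat k (matPoly A)) (revMat 1 L)

/-! ### shifted sums -/

/-- Column shifted sum `X ⊞→ Y`. -/
def colShiftSum {k m n : ℕ} (Xc Yc : Matrix (Fin k × Fin m) (Fin k × Fin n) F) :
    Matrix (Fin k × Fin m) (Fin (k + 1) × Fin n) F :=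
  Matrix.of fun p q =>
    (if h : (q.1 : ℕ) < k then Xc p (⟨(q.1 : ℕ), h⟩, q.2) else 0) +
    (if h : 0 < (q.1 : ℕ) then
        Yc p (⟨(q.1 : ℕ) - 1, by have := q.1.isLt; omega⟩, q.2)
      else 0)

/-- Row shifted sum `X ⊞↓ Y`. -/
def rowShiftSum {k m n : ℕ} (Xc Yc : Matrix (Fin k × Fin m) (Fin k × Fin n) F) :
    Matrix (Fin (k + 1) × Fin m) (Fin k × Fin n) F :=
  Matrix.of fun p q =>
    (if h : (p.1 : ℕ) < k then Xc (⟨(p.1 : ℕ), h⟩, p.2) q else 0) +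
    (if h : 0 < (p.1 : ℕ) then
        Yc (⟨(p.1 : ℕ) - 1, by have := p.1.isLt; omega⟩, p.2) q
      else 0)

/-! ### the parametrization of `𝕃₁(P)` and `𝕃₂(P)` -/

/-- `X = [v ⊗ A_k ∣ -W]`. -/
def L1X {k m n : ℕ} (A : Fin (k + 1) → Matrix (Fin m) (Fin n) F) (v : Fin k → F)
    (W : Matrix (Fin k × Fin m) (Fin (k - 1) × Fin n) F) :
    Matrix (Fin k × Fin m) (Fin k × Fin n) F :=
  Matrix.of fun p q =>
    if h : (q.1 : ℕ) = 0 then v p.1 * A (Fin.last k) p.2 q.2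
    else -W p (⟨(q.1 : ℕ) - 1, by have := q.1.isLt; omega⟩, q.2)

/-- `Y = [W + v ⊗ [A_{k-1} ⋯ A_1] ∣ v ⊗ A_0]`. -/
def L1Y {k m n : ℕ} (A : Fin (k + 1) → Matrix (Fin m) (Fin n) F) (v : Fin k → F)
    (W : Matrix (Fin k × Fin m) (Fin (k - 1) × Fin n) F) :
    Matrix (Fin k × Fin m) (Fin k × Fin n) F :=
  Matrix.of fun p q =>
    if h : (q.1 : ℕ) < k - 1 then
      W p (⟨(q.1 : ℕ), h⟩, q.2) + v p.1 * A (⟨k - 1 - (q.1 : ℕ), by omega⟩) p.2 q.2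
    else v p.1 * A 0 p.2 q.2

/-- `X = [wᵀ ⊗ A_k ; -Ŵ]`. -/
def L2X {k m n : ℕ} (A : Fin (k + 1) → Matrix (Fin m) (Fin n) F) (w : Fin k → F)
    (W : Matrix (Fin (k - 1) × Fin m) (Fin k × Fin n) F) :
    Matrix (Fin k × Fin m) (Fin k × Fin n) F :=
  Matrix.of fun p q =>
    if h : (p.1 : ℕ) = 0 then w q.1 * A (Fin.last k) p.2 q.2
    else -W (⟨(p.1 : ℕ) - 1, by have := p.1.isLt; omega⟩, p.2) q

/-- `Y = [Ŵ + wᵀ ⊗ [A_{k-1}ᵀ ⋯ A_1ᵀ]ᵀ ; wᵀ ⊗ A_0]`. -/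
def L2Y {k m n : ℕ} (A : Fin (k + 1) → Matrix (Fin m) (Fin n) F) (w : Fin k → F)
    (W : Matrix (Fin (k - 1) × Fin m) (Fin k × Fin n) F) :
    Matrix (Fin k × Fin m) (Fin k × Fin n) F :=
  Matrix.of fun p q =>
    if h : (p.1 : ℕ) < k - 1 then
      W (⟨(p.1 : ℕ), h⟩, p.2) q + w q.1 * A (⟨k - 1 - (p.1 : ℕ), by omega⟩) p.2 q.2
    else w q.1 * A 0 p.2 q.2

/-! ### block structure and `Z`-matrices -/

/-- Assemble a `km × kn` matrix from blocks with row split `m + (k-1)m` and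
column split `n + (k-1)n`. -/
def blk {k m n : ℕ} (TL : Matrix (Fin m) (Fin n) F)
    (TR : Matrix (Fin m) (Fin (k - 1) × Fin n) F)
    (BL : Matrix (Fin (k - 1) × Fin m) (Fin n) F)
    (BR : Matrix (Fin (k - 1) × Fin m) (Fin (k - 1) × Fin n) F) :
    Matrix (Fin k × Fin m) (Fin k × Fin n) F :=
  Matrix.of fun p q =>
    if hp : (p.1 : ℕ) = 0 then
      if hq : (q.1 : ℕ) = 0 then TL p.2 q.2
      else TR p.2 (⟨(q.1 : ℕ) - 1, by have := q.1.isLt; omega⟩, q.2)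
    else
      if hq : (q.1 : ℕ) = 0 then
        BL (⟨(p.1 : ℕ) - 1, by have := p.1.isLt; omega⟩, p.2) q.2
      else
        BR (⟨(p.1 : ℕ) - 1, by have := p.1.isLt; omega⟩, p.2)
          (⟨(q.1 : ℕ) - 1, by have := q.1.isLt; omega⟩, q.2)

/-- Assemble `[[Y₁₁, T],[Z, 0]]`, row split `m + (k-1)m`, column split `(k-1)n + n`. -/
def blkY1 {k m n : ℕ} (Y11 : Matrix (Fin m) (Fin (k - 1) × Fin n) F)
    (T : Matrix (Fin m) (Fin n) F)
    (Z : Matrix (Fin (k - 1) × Fin m) (Fin (k - 1) × Fin n) F) :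
    Matrix (Fin k × Fin m) (Fin k × Fin n) F :=
  Matrix.of fun p q =>
    if hp : (p.1 : ℕ) = 0 then
      if hq : (q.1 : ℕ) < k - 1 then Y11 p.2 (⟨(q.1 : ℕ), hq⟩, q.2) else T p.2 q.2
    else
      if hq : (q.1 : ℕ) < k - 1 then
        Z (⟨(p.1 : ℕ) - 1, by have := p.1.isLt; omega⟩, p.2) (⟨(q.1 : ℕ), hq⟩, q.2)
      else 0

/-- Assemble `[[Y₁₁, Z],[T, 0]]`, row split `(k-1)m + m`, column split `n + (k-1)n`. -/
def blkY2 {k m n : ℕ} (Y11 : Matrix (Fin (k - 1) × Fin m) (Fin n) F)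
    (Z : Matrix (Fin (k - 1) × Fin m) (Fin (k - 1) × Fin n) F)
    (T : Matrix (Fin m) (Fin n) F) :
    Matrix (Fin k × Fin m) (Fin k × Fin n) F :=
  Matrix.of fun p q =>
    if hp : (p.1 : ℕ) < k - 1 then
      if hq : (q.1 : ℕ) = 0 then Y11 (⟨(p.1 : ℕ), hp⟩, p.2) q.2
      else Z (⟨(p.1 : ℕ), hp⟩, p.2) (⟨(q.1 : ℕ) - 1, by have := q.1.isLt; omega⟩, q.2)
    else
      if hq : (q.1 : ℕ) = 0 then T p.2 q.2 else 0

/-- The `Z`-matrix of `L = λX + Y ∈ 𝕃₁(P)` with respect to `M`: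
the lower-left `(k-1)m × (k-1)n` block of `(M ⊗ I_m) Y`. -/
def Zmat1 {k m n : ℕ} (M : Matrix (Fin k) (Fin k) F)
    (Yc : Matrix (Fin k × Fin m) (Fin k × Fin n) F) :
    Matrix (Fin (k - 1) × Fin m) (Fin (k - 1) × Fin n) F :=
  Matrix.of fun p q =>
    (kronId M * Yc : Matrix (Fin k × Fin m) (Fin k × Fin n) F)
      (⟨(p.1 : ℕ) + 1, by have := p.1.isLt; omega⟩, p.2)
      (⟨(q.1 : ℕ), by have := q.1.isLt; omega⟩, q.2)

/-- The `Z`-matrix of `L = λX + Y ∈ 𝕃₂(P)` with respect to `M̂`: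
the upper-right `(k-1)m × (k-1)n` block of `Y (M̂ᵀ ⊗ I_n)`. -/
def Zmat2 {k m n : ℕ} (M : Matrix (Fin k) (Fin k) F)
    (Yc : Matrix (Fin k × Fin m) (Fin k × Fin n) F) :
    Matrix (Fin (k - 1) × Fin m) (Fin (k - 1) × Fin n) F :=
  Matrix.of fun p q =>
    (Yc * kronId Mᵀ : Matrix (Fin k × Fin m) (Fin k × Fin n) F)
      (⟨(p.1 : ℕ), by have := p.1.isLt; omega⟩, p.2)
      (⟨(q.1 : ℕ) + 1, by have := q.1.isLt; omega⟩, q.2)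

/-- `L = λX + Y ∈ 𝕃₁(P)` with right ansatz vector `v` has full `Z`-rank. -/
def FullZrank1 {k m n : ℕ} (Yc : Matrix (Fin k × Fin m) (Fin k × Fin n) F)
    (v : Fin k → F) : Prop :=
  ∃ (M : Matrix (Fin k) (Fin k) F) (α : F),
    IsUnit M ∧ α ≠ 0 ∧ M.mulVec v = e1 α ∧ (Zmat1 M Yc).rank = (k - 1) * n

/-- `L = λX + Y ∈ 𝕃₂(P)` with left ansatz vector `w` has full `Z`-rank. -/
def FullZrank2 {k m n : ℕ} (Yc : Matrix (Fin k × Fin m) (Fin k × Fin n) F)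
    (w : Fin k → F) : Prop :=
  ∃ (M : Matrix (Fin k) (Fin k) F) (α : F),
    IsUnit M ∧ α ≠ 0 ∧ M.mulVec w = e1 α ∧ (Zmat2 M Yc).rank = (k - 1) * m

/-! ### null spaces, minimal bases and minimal indices over `F(λ)` -/

/-- A matrix polynomial viewed as a matrix over the field of rational functions. -/
def matRF {ρ γ : Type*} (P : Matrix ρ γ F[X]) : Matrix ρ γ (RatFunc F) :=
  P.map (algebraMap F[X] (RatFunc F))

/-- The right null space `N_r(P) = {x(λ) : P(λ) x(λ) ≡ 0}` over `F(λ)`. -/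
def Nr {ρ γ : Type*} [Fintype γ] (P : Matrix ρ γ F[X]) :
    Submodule (RatFunc F) (γ → RatFunc F) :=
  LinearMap.ker (Matrix.mulVecLin (matRF P))

/-- The left null space `N_l(P) = {y(λ) : y(λ)ᵀ P(λ) ≡ 0}` over `F(λ)`. -/
def Nl {ρ γ : Type*} [Fintype ρ] (P : Matrix ρ γ F[X]) :
    Submodule (RatFunc F) (ρ → RatFunc F) :=
  Nr Pᵀ

/-- The normal rank of a matrix polynomial: its rank over `F(λ)`. -/
def nrank {ρ γ : Type*} [Fintype γ] (P : Matrix ρ γ F[X]) : ℕ :=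
  (matRF P).rank

/-- The rational vector determined by a vector polynomial. -/
def polyVec {γ : Type*} (x : γ → F[X]) : γ → RatFunc F :=
  fun i => algebraMap F[X] (RatFunc F) (x i)

/-- A rational vector is a vector polynomial if all its entries are polynomials. -/
def IsVecPoly {γ : Type*} (x : γ → RatFunc F) : Prop :=
  ∃ p : γ → F[X], x = polyVec p

/-- The degree of a vector polynomial: the greatest degree of its components. -/
def polyVecDeg {γ : Type*} [Fintype γ] (x : γ → F[X]) : ℕ :=
  Finset.univ.sup fun i => (x i).natDegree

/-- A polynomial basis of the subspace `V` of `F(λ)^γ`. -/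
def IsPolyBasis {γ ι : Type*} [Fintype γ]
    (V : Submodule (RatFunc F) (γ → RatFunc F)) (b : ι → γ → F[X]) : Prop :=
  LinearIndependent (RatFunc F) (fun i => polyVec (b i)) ∧
    Submodule.span (RatFunc F) (Set.range fun i => polyVec (b i)) = V

/-- A minimal basis of `V`: a polynomial basis of least order (sum of degrees). -/
def IsMinimalBasis {γ ι : Type*} [Fintype γ] [Fintype ι]
    (V : Submodule (RatFunc F) (γ → RatFunc F)) (b : ι → γ → F[X]) : Prop :=
  IsPolyBasis V b ∧
    ∀ (d : ℕ) (b' : Fin d → γ → F[X]), IsPolyBasis V b' →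
      ∑ i, polyVecDeg (b i) ≤ ∑ i, polyVecDeg (b' i)

/-- `ε` is the list of minimal indices of `V`: some minimal basis of `V` has
`ε` as its list of degrees. -/
def HasMinIndices {γ : Type*} [Fintype γ]
    (V : Submodule (RatFunc F) (γ → RatFunc F)) {d : ℕ} (ε : Fin d → ℕ) : Prop :=
  ∃ b : Fin d → γ → F[X], IsMinimalBasis V b ∧ ∀ i, polyVecDeg (b i) = ε i

/-- `Λ_k(λ) ⊗ x(λ)`. -/
def lamTensor {n : ℕ} (k : ℕ) (x : Fin n → RatFunc F) : Fin k × Fin n → RatFunc F :=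
  fun p => algebraMap F[X] (RatFunc F) (Polynomial.X ^ (k - 1 - (p.1 : ℕ))) * x p.2

/-- The matrix `vᵀ ⊗ I_m` over `F(λ)`; `𝓛_v(y) = (vproj v).mulVec y`. -/
def vproj {k m : ℕ} (v : Fin k → F) : Matrix (Fin m) (Fin k × Fin m) (RatFunc F) :=
  Matrix.of fun r p =>
    if r = p.2 then algebraMap F[X] (RatFunc F) (Polynomial.C (v p.1)) else 0

/-- `(vᵀ ⊗ I_m) y` at the level of vector polynomials. -/
def LvPoly {k m : ℕ} (v : Fin k → F) (y : Fin k × Fin m → F[X]) : Fin m → F[X] :=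
  fun r => ∑ i : Fin k, Polynomial.C (v i) * y (i, r)

/-- The rational subspace spanned by the rows of a matrix polynomial. -/
def rowSpan {ρ γ : Type*} [Fintype γ] (B : Matrix ρ γ F[X]) :
    Submodule (RatFunc F) (γ → RatFunc F) :=
  Submodule.span (RatFunc F) (Set.range fun i => polyVec (B i))

/-- A matrix polynomial is a minimal basis if its rows form a minimal basis of the
rational subspace they span. -/
def IsMinimalBasisMat {ρ γ : Type*} [Fintype ρ] [Fintype γ] (B : Matrix ρ γ F[X]) : Prop :=
  IsMinimalBasis (rowSpan B) (fun i => B i)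

/-- Dual minimal bases: `B ∈ F[λ]^{n₁×n}`, `C ∈ F[λ]^{n₂×n}` minimal bases with
`n₁ + n₂ = n` and `B Cᵀ = 0`. -/
def DualMinBases {ρ ρ' γ : Type*} [Fintype ρ] [Fintype ρ'] [Fintype γ]
    (B : Matrix ρ γ F[X]) (Cm : Matrix ρ' γ F[X]) : Prop :=
  IsMinimalBasisMat B ∧ IsMinimalBasisMat Cm ∧
    Fintype.card ρ + Fintype.card ρ' = Fintype.card γ ∧ B * Cmᵀ = 0

/-! ### norms, singular values -/

/-- Square of the Frobenius norm of a constant matrix. -/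
def frobSq {ρ γ : Type*} [Fintype ρ] [Fintype γ] (Ac : Matrix ρ γ F) : ℝ :=
  ∑ i, ∑ j, ‖Ac i j‖ ^ 2

/-- `‖λX + Y‖_F = sqrt(‖X‖_F² + ‖Y‖_F²)`. -/
def penFrob {ρ γ : Type*} [Fintype ρ] [Fintype γ] (Xc Yc : Matrix ρ γ F) : ℝ :=
  Real.sqrt (frobSq Xc + frobSq Yc)

/-- `‖P‖_F = sqrt(∑ ‖A_i‖_F²)` for `P(λ) = ∑ λ^i A_i`. -/
def famFrob {k m n : ℕ} (A : Fin (k + 1) → Matrix (Fin m) (Fin n) F) : ℝ :=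
  Real.sqrt (∑ i, frobSq (A i))

/-- `‖P‖_F` for a matrix polynomial of grade `g`. -/
def mpolyFrob {ρ γ : Type*} [Fintype ρ] [Fintype γ] (g : ℕ) (P : Matrix ρ γ F[X]) : ℝ :=
  Real.sqrt (∑ i, ∑ j, ∑ d ∈ Finset.range (g + 1), ‖(P i j).coeff d‖ ^ 2)

/-- Square of the Euclidean norm of a vector. -/
def vecNormSq {ι : Type*} [Fintype ι] (x : ι → F) : ℝ := ∑ i, ‖x i‖ ^ 2

/-- The smallest singular value of a matrix. -/
def sigmaMin {ρ γ : Type*} [Fintype ρ] [Fintype γ] (Ac : Matrix ρ γ F) : ℝ :=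
  if Fintype.card γ ≤ Fintype.card ρ then
    sInf {r : ℝ | ∃ x : γ → F, vecNormSq x = 1 ∧ r = Real.sqrt (vecNormSq (Ac.mulVec x))}
  else
    sInf {r : ℝ | ∃ y : ρ → F, vecNormSq y = 1 ∧ r = Real.sqrt (vecNormSq (Acᴴ.mulVec y))}

/-- The spectral norm (2-norm) of a matrix. -/
def norm2 {ρ γ : Type*} [Fintype ρ] [Fintype γ] (Ac : Matrix ρ γ F) : ℝ :=
  sSup {r : ℝ | ∃ x : γ → F, vecNormSq x = 1 ∧ r = Real.sqrt (vecNormSq (Ac.mulVec x))}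

/-- `κ₂(D) = ‖D‖₂ ‖D⁻¹‖₂`. -/
def cond2 {ρ : Type*} [Fintype ρ] [DecidableEq ρ] (Dc : Matrix ρ ρ F) : ℝ :=
  norm2 Dc * norm2 Dc⁻¹

/-! ### pencils used in the backward error analysis -/

/-- `B(λ) = λ [0 ∣ -R̃] + [R̃ ∣ 0]`, i.e. `R̃ (H_{k-1}(λ) ⊗ I_n)` up to sign conventions. -/
def Bpencil {k n : ℕ} (R : Matrix (Fin (k - 1) × Fin n) (Fin (k - 1) × Fin n) F) :
    Matrix (Fin (k - 1) × Fin n) (Fin k × Fin n) F[X] :=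
  Matrix.of fun p q =>
    (if h : (q.1 : ℕ) < k - 1 then Polynomial.C (R p (⟨(q.1 : ℕ), h⟩, q.2)) else 0) +
    (if h : 0 < (q.1 : ℕ) then
        Polynomial.X *
          Polynomial.C (-R p (⟨(q.1 : ℕ) - 1, by have := q.1.isLt; omega⟩, q.2))
      else 0)

/-- The coefficient of `λ` in `H_{k-1}(λ) ⊗ I_n`. -/
def Hlam (F : Type*) [RCLike F] (k n : ℕ) :
    Matrix (Fin (k - 1) × Fin n) (Fin k × Fin n) F :=
  Matrix.of fun p q => if p.2 = q.2 ∧ (q.1 : ℕ) = (p.1 : ℕ) + 1 then 1 else 0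

/-- The constant coefficient of `H_{k-1}(λ) ⊗ I_n`. -/
def Hconst (F : Type*) [RCLike F] (k n : ℕ) :
    Matrix (Fin (k - 1) × Fin n) (Fin k × Fin n) F :=
  Matrix.of fun p q => if p.2 = q.2 ∧ (q.1 : ℕ) = (p.1 : ℕ) then -1 else 0

/-- The convolution matrix `C_j(λ Xc + Yc)` of a pencil, with `j+1` block columns. -/
def convPencil {ρ γ : Type*} (Xc Yc : Matrix ρ γ F) (j : ℕ) :
    Matrix (Fin (j + 2) × ρ) (Fin (j + 1) × γ) F :=
  Matrix.of fun r c =>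
    if (r.1 : ℕ) = (c.1 : ℕ) then Xc r.2 c.2
    else if (r.1 : ℕ) = (c.1 : ℕ) + 1 then Yc r.2 c.2 else 0

/-- λ-coefficient of the trimmed pencil `L̂_t(λ)`:
`[[α A_k, X₁₂],[0, -R̃]]` with row split `m + (k-1)n`. -/
def LtX {k m n : ℕ} (α : F) (Ak : Matrix (Fin m) (Fin n) F)
    (X12 : Matrix (Fin m) (Fin (k - 1) × Fin n) F)
    (R : Matrix (Fin (k - 1) × Fin n) (Fin (k - 1) × Fin n) F) :
    Matrix (Fin m ⊕ (Fin (k - 1) × Fin n)) (Fin k × Fin n) F :=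
  Matrix.of fun s q =>
    Sum.elim
      (fun r => if h : (q.1 : ℕ) = 0 then α * Ak r q.2
        else X12 r (⟨(q.1 : ℕ) - 1, by have := q.1.isLt; omega⟩, q.2))
      (fun p => if h : (q.1 : ℕ) = 0 then 0
        else -R p (⟨(q.1 : ℕ) - 1, by have := q.1.isLt; omega⟩, q.2)) s

/-- Constant coefficient of the trimmed pencil `L̂_t(λ)`:
`[[Y₁₁, α A₀],[R̃, 0]]` with row split `m + (k-1)n`. -/
def LtY {k m n : ℕ} (α : F) (A0 : Matrix (Fin m) (Fin n) F)
    (Y11 : Matrix (Fin m) (Fin (k - 1) × Fin n) F)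
    (R : Matrix (Fin (k - 1) × Fin n) (Fin (k - 1) × Fin n) F) :
    Matrix (Fin m ⊕ (Fin (k - 1) × Fin n)) (Fin k × Fin n) F :=
  Matrix.of fun s q =>
    Sum.elim
      (fun r => if h : (q.1 : ℕ) < k - 1 then Y11 r (⟨(q.1 : ℕ), h⟩, q.2)
        else α * A0 r q.2)
      (fun p => if h : (q.1 : ℕ) < k - 1 then R p (⟨(q.1 : ℕ), h⟩, q.2) else 0) s

/-! ### trimming -/

/-- The rows `[0 ∣ Q₂*] (M ⊗ I_m)`. -/
def bottomRows {k m n c : ℕ} (M : Matrix (Fin k) (Fin k) F)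
    (Q : Matrix (Fin (k - 1) × Fin m) ((Fin (k - 1) × Fin n) ⊕ Fin c) F) :
    Matrix (Fin c) (Fin k × Fin m) F :=
  (Matrix.of fun (j : Fin c) (p : Fin k × Fin m) =>
      if h : (p.1 : ℕ) = 0 then 0
      else star (Q (⟨(p.1 : ℕ) - 1, by have := p.1.isLt; omega⟩, p.2) (Sum.inr j)))
    * kronId M

/-- The square matrix `[D ; [0 ∣ Q₂*](M ⊗ I_m)]` whose invertibility makes `D` admissible. -/
def trimAux {k m n c : ℕ} (M : Matrix (Fin k) (Fin k) F)
    (Q : Matrix (Fin (k - 1) × Fin m) ((Fin (k - 1) × Fin n) ⊕ Fin c) F)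
    (D : Matrix (Fin m ⊕ (Fin (k - 1) × Fin n)) (Fin k × Fin m) F) :
    Matrix ((Fin m ⊕ (Fin (k - 1) × Fin n)) ⊕ Fin c) (Fin k × Fin m) F :=
  Matrix.of (Sum.elim (fun i j => D i j) (fun i j => bottomRows M Q i j))

/-- The columns `(M̂ᵀ ⊗ I_n) [0 ; Q₂]`. -/
def rightCols {k m n c : ℕ} (M : Matrix (Fin k) (Fin k) F)
    (Q : Matrix (Fin (k - 1) × Fin n) ((Fin (k - 1) × Fin m) ⊕ Fin c) F) :
    Matrix (Fin k × Fin n) (Fin c) F :=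
  kronId Mᵀ *
    (Matrix.of fun (q : Fin k × Fin n) (j : Fin c) =>
      if h : (q.1 : ℕ) = 0 then 0
      else Q (⟨(q.1 : ℕ) - 1, by have := q.1.isLt; omega⟩, q.2) (Sum.inr j))

/-- The square matrix `[D̂ ∣ (M̂ᵀ ⊗ I_n)[0 ; Q₂]]` whose invertibility makes `D̂` admissible. -/
def trimAux2 {k m n c : ℕ} (M : Matrix (Fin k) (Fin k) F)
    (Q : Matrix (Fin (k - 1) × Fin n) ((Fin (k - 1) × Fin m) ⊕ Fin c) F)
    (D : Matrix (Fin k × Fin n) (Fin n ⊕ (Fin (k - 1) × Fin m)) F) :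
    Matrix (Fin k × Fin n) ((Fin n ⊕ (Fin (k - 1) × Fin m)) ⊕ Fin c) F :=
  Matrix.of fun q s => Sum.elim (fun t => D q t) (fun j => rightCols M Q q j) s

/-! ### Auxiliary facts on matrices over a field -/

/-- Two matrices of the same size with injective action differ by a nonsingular left factor. -/
theorem exists_isUnit_mul_eq {K ρ γ : Type*} [Field K] [Fintype ρ] [DecidableEq ρ]
    [Fintype γ] [DecidableEq γ] {Z J : Matrix ρ γ K}
    (hZ : Function.Injective Z.mulVec) (hJ : Function.Injective J.mulVec) :
    ∃ T : Matrix ρ ρ K, IsUnit T ∧ T * Z = J := by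
  obtain ⟨e, he⟩ := Submodule.exists_linearEquiv_restrict_eq
    ((LinearEquiv.ofInjective Z.mulVecLin hZ).symm ≪≫ₗ LinearEquiv.ofInjective J.mulVecLin hJ)
  have heq : e.toLinearMap ∘ₗ Z.mulVecLin = J.mulVecLin := LinearMap.ext fun x => by
    have := he (LinearEquiv.ofInjective Z.mulVecLin hZ x)
    rw [LinearEquiv.trans_apply, LinearEquiv.symm_apply_apply] at this
    exact this.symm
  refine ⟨LinearMap.toMatrix' e.toLinearMap, ?_, ?_⟩
  · refine IsUnit.of_mul_eq_one (LinearMap.toMatrix' e.symm.toLinearMap) ?_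
    rw [← LinearMap.toMatrix'_comp]
    simp
  · apply Matrix.toLin'.injective
    rw [Matrix.toLin'_mul, Matrix.toLin'_toMatrix']
    exact heq

theorem mulVec_injective_of_rank_eq {K ρ γ : Type*} [Field K] [Fintype ρ] [Fintype γ]
    {Z : Matrix ρ γ K} (hZ : Z.rank = Fintype.card γ) : Function.Injective Z.mulVec := by
  rw [Matrix.mulVec_injective_iff, linearIndependent_iff_card_eq_finrank_span, ← hZ,
    Matrix.rank_eq_finrank_span_cols]
  rfl

/-- `I_K ⊗ I_{m,n}`. -/
def eyeBlocks (F : Type*) [RCLike F] (K m n : ℕ) : Matrix (Fin K × Fin m) (Fin K × Fin n) F :=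
  Matrix.of fun p q => if p.1 = q.1 ∧ (p.2 : ℕ) = (q.2 : ℕ) then 1 else 0

theorem eyeBlocks_mulVec_injective {K m n : ℕ} (hmn : n ≤ m) :
    Function.Injective (eyeBlocks F K m n).mulVec := by
  refine Function.LeftInverse.injective
    (g := fun y q => y (q.1, Fin.castLE hmn q.2)) fun x => funext fun q => ?_
  rw [Matrix.mulVec, dotProduct, Finset.sum_eq_single q]
  · simp [eyeBlocks]
  · rintro ⟨i, j⟩ - h
    rw [eyeBlocks, Matrix.of_apply, if_neg, zero_mul]
    rintro ⟨h1, h2⟩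
    exact h (Prod.ext h1.symm (Fin.ext h2.symm))
  · simp

/-! ### Splitting off one block row or block column -/

/-- Block indices, with the first block split off. -/
def firstBlock (K m : ℕ) : Fin m ⊕ (Fin K × Fin m) ≃ Fin (K + 1) × Fin m where
  toFun := Sum.elim (fun a => (0, a)) fun p => (p.1.succ, p.2)
  invFun p := Fin.cases (Sum.inl p.2) (fun i => Sum.inr (i, p.2)) p.1
  left_inv s := by rcases s with a | p <;> rfl
  right_inv p := by
    obtain ⟨i, a⟩ := p
    refine Fin.cases ?_ (fun i => ?_) i <;> rfl

/-- Block indices, with the last block split off. -/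
def lastBlock (K m : ℕ) : Fin m ⊕ (Fin K × Fin m) ≃ Fin (K + 1) × Fin m where
  toFun := Sum.elim (fun a => (Fin.last K, a)) fun p => (p.1.castSucc, p.2)
  invFun p := Fin.lastCases (Sum.inl p.2) (fun i => Sum.inr (i, p.2)) p.1
  left_inv s := by rcases s with a | p <;> simp
  right_inv p := by
    obtain ⟨i, a⟩ := p
    refine Fin.lastCases ?_ (fun i => ?_) i <;> simp

theorem isGLin_of_blocks {K m n : ℕ} {P : Matrix (Fin m) (Fin n) F[X]}
    {L : Matrix (Fin (K + 1) × Fin m) (Fin (K + 1) × Fin n) F[X]}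
    (c : Fin n ⊕ (Fin K × Fin n) ≃ Fin (K + 1) × Fin n)
    {E : Matrix (Fin m ⊕ (Fin K × Fin m)) (Fin m ⊕ (Fin K × Fin m)) F[X]}
    {G : Matrix (Fin n ⊕ (Fin K × Fin n)) (Fin n ⊕ (Fin K × Fin n)) F[X]}
    (hE : IsUnit E) (hG : IsUnit G)
    (h : E * L.submatrix (firstBlock K m) c * G =
      Matrix.fromBlocks P 0 0 ((eyeBlocks F K m n).map Polynomial.C)) :
    IsGLin P L := by
  refine ⟨E.submatrix (firstBlock K m).symm (firstBlock K m).symm,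
    G.submatrix c.symm (firstBlock K n).symm, ?_, ?_, ?_⟩
  · rwa [← Matrix.isUnit_iff_isUnit_det, Matrix.isUnit_submatrix_equiv]
  · rwa [← Matrix.isUnit_iff_isUnit_det, Matrix.isUnit_submatrix_equiv]
  · have hL : L = (L.submatrix (firstBlock K m) c).submatrix (firstBlock K m).symm c.symm := by
      simp
    rw [hL, Matrix.submatrix_mul_equiv, Matrix.submatrix_mul_equiv, h]
    ext1 p q
    obtain ⟨p, rfl⟩ := (firstBlock K m).surjective p
    obtain ⟨q, rfl⟩ := (firstBlock K n).surjective q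
    rcases p with a | p <;> rcases q with b | q <;>
      simp [firstBlock, glinTarget, eyeBlocks, Fin.succ_ne_zero, (Fin.succ_ne_zero _).symm, ite_and, apply_ite Polynomial.C]

/-- Elimination in a block matrix whose lower right block is constant of full column rank. -/
theorem exists_isUnit_mul_fromBlocks {ρ γ μ ν : Type*} [Fintype ρ] [DecidableEq ρ]
    [Fintype γ] [DecidableEq γ] [Fintype μ] [DecidableEq μ] 
    (P : Matrix μ ν F[X]) (W : Matrix μ γ F[X]) {α : F} (hα : α ≠ 0) {Z J : Matrix ρ γ F}
    (hZ : Function.Injective Z.mulVec) (hJ : Function.Injective J.mulVec) :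
    ∃ E : Matrix (μ ⊕ ρ) (μ ⊕ ρ) F[X], IsUnit E ∧
      E * Matrix.fromBlocks (Polynomial.C α • P) W 0 (Z.map Polynomial.C) =
        Matrix.fromBlocks P 0 0 (J.map Polynomial.C) := by
  obtain ⟨T, hT, hTZ⟩ := exists_isUnit_mul_eq hZ hJ
  obtain ⟨B, hB⟩ := LinearMap.exists_leftInverse_of_injective Z.mulVecLin
    (LinearMap.ker_eq_bot.2 hZ)
  have hB' : LinearMap.toMatrix' B * Z = 1 := by
    apply Matrix.toLin'.injective
    rw [Matrix.toLin'_mul, Matrix.toLin'_toMatrix', Matrix.toLin'_one]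
    exact hB
  have hc : Polynomial.C α⁻¹ * Polynomial.C α = 1 := by
    rw [← Polynomial.C_mul, inv_mul_cancel₀ hα, Polynomial.C_1]
  refine ⟨Matrix.fromBlocks (Polynomial.C α⁻¹ • 1)
    (-(Polynomial.C α⁻¹ • (W * (LinearMap.toMatrix' B).map Polynomial.C))) 0
    (T.map Polynomial.C), ?_, ?_⟩
  · rw [Matrix.isUnit_iff_isUnit_det, Matrix.det_fromBlocks_zero₂₁]
    refine IsUnit.mul ?_ ?_
    · rw [Matrix.det_smul, Matrix.det_one, mul_one]
      exact (IsUnit.of_mul_eq_one _ hc).pow _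
    · rw [Matrix.isUnit_iff_isUnit_det] at hT
      have := hT.map (Polynomial.C : F →+* F[X])
      rwa [RingHom.map_det] at this
  · rw [Matrix.fromBlocks_multiply]
    have h1 : (LinearMap.toMatrix' B).map Polynomial.C * Z.map Polynomial.C = 1 := by
      rw [← Matrix.map_mul, hB']; simp
    have h2 : T.map Polynomial.C * Z.map Polynomial.C = J.map Polynomial.C := by
      rw [← Matrix.map_mul, hTZ]
    congr 1
    · simp [smul_smul, mul_comm (Polynomial.C α), hc]
    · simp [Matrix.mul_assoc, h1]
    · simp
    · simp [h2]

/-! ### The ansatz identity in terms of coefficients -/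

theorem sum_C_mul_X_pow_inj {N : ℕ} (a b : Fin N → F) :
    ∑ i, Polynomial.C (a i) * Polynomial.X ^ (i : ℕ) =
      ∑ i, Polynomial.C (b i) * Polynomial.X ^ (i : ℕ) ↔ ∀ i, a i = b i := by
  refine ⟨fun h i => ?_, fun h => by simp only [h]⟩
  simpa [Polynomial.finsetSum_coeff, Polynomial.coeff_C_mul, Polynomial.coeff_X_pow, Fin.val_inj]
    using congrArg (fun p => p.coeff (i : ℕ)) h

theorem ansatz_sum_iff {K : ℕ} (x y : Fin (K + 1) → F) (a : Fin (K + 2) → F) :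
    (∑ j : Fin (K + 1), (Polynomial.C (x j) * Polynomial.X + Polynomial.C (y j)) *
        Polynomial.X ^ (K - (j : ℕ)) =
      ∑ i : Fin (K + 2), Polynomial.C (a i) * Polynomial.X ^ (i : ℕ)) ↔
    x 0 = a (Fin.last _) ∧ y (Fin.last K) = a 0 ∧
      ∀ j : Fin K, y j.castSucc + x j.succ = a j.castSucc.succ.rev := by
  have key : ∑ j : Fin (K + 1), (Polynomial.C (x j) * Polynomial.X + Polynomial.C (y j)) *
        Polynomial.X ^ (K - (j : ℕ)) =
      ∑ i : Fin (K + 2), Polynomial.C ((Fin.cons (x 0) (Fin.snoc (α := fun _ => F)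
        (fun j : Fin K => y j.castSucc + x j.succ) (y (Fin.last K))) : Fin (K + 2) → F) i.rev) *
          Polynomial.X ^ (i : ℕ) := by
    have hx : ∀ j : Fin (K + 1), Polynomial.C (x j) * Polynomial.X * Polynomial.X ^ (K - (j : ℕ)) =
        Polynomial.C (x j) * Polynomial.X ^ (K + 1 - (j : ℕ)) := fun j => by
      rw [mul_assoc, ← pow_succ', Nat.sub_add_comm (Nat.le_of_lt_succ j.isLt)]
    simp only [add_mul, hx, Finset.sum_add_distrib]
    rw [← Equiv.sum_comp Fin.revPerm (fun i : Fin (K + 2) => _ * _), Fin.sum_univ_succ,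
      Fin.sum_univ_castSucc (n := K), Fin.sum_univ_succ (n := K + 1),
      Fin.sum_univ_castSucc (n := K)]
    simp [Fin.val_rev, add_mul, Finset.sum_add_distrib]
    ring
  rw [key, sum_C_mul_X_pow_inj, ← Fin.revPerm.forall_congr_right, Fin.forall_fin_succ,
    Fin.forall_fin_succ']
  simp [and_comm]

theorem rightAnsatz_iff {K m n : ℕ} (A : Fin (K + 2) → Matrix (Fin m) (Fin n) F)
    (X Y : Matrix (Fin (K + 1) × Fin m) (Fin (K + 1) × Fin n) F) (v : Fin (K + 1) → F) :
    RightAnsatz (matPoly A) (pencil X Y) v ↔ ∀ p c,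
      X p (0, c) = v p.1 * A (Fin.last _) p.2 c ∧
      Y p (Fin.last K, c) = v p.1 * A 0 p.2 c ∧
      ∀ j : Fin K, Y p (j.castSucc, c) + X p (j.succ, c) =
        v p.1 * A j.castSucc.succ.rev p.2 c := by
  rw [RightAnsatz, ← Matrix.ext_iff]
  refine forall₂_congr fun p c => ?_
  rw [← ansatz_sum_iff (fun j => X p (j, c)) (fun j => Y p (j, c)) fun i => v p.1 * A i p.2 c]
  simp only [Matrix.mul_apply, Fintype.sum_prod_type, Lam, pencil, vkron, matPoly, Matrix.of_apply,
    mul_ite, mul_zero, Finset.sum_ite_eq', Finset.mem_univ, if_true, Finset.mul_sum,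
    Polynomial.C_mul, mul_assoc, Nat.add_sub_cancel]

theorem map_C_mul_pencil {ρ σ γ : Type*} [Fintype σ] (N : Matrix ρ σ F) (X Y : Matrix σ γ F) :
    N.map Polynomial.C * pencil X Y = pencil (N * X) (N * Y) := by
  ext1 i j
  simp [Matrix.mul_apply, pencil, Finset.sum_mul, mul_add, Finset.sum_add_distrib, mul_assoc]

theorem kronId_mul_apply {k m : ℕ} {γ : Type*} (M : Matrix (Fin k) (Fin k) F)
    (X : Matrix (Fin k × Fin m) γ F) (p : Fin k × Fin m) (q : γ) :
    ((kronId M : Matrix (Fin k × Fin m) (Fin k × Fin m) F) * X) p q = ∑ i, M p.1 i * X (i, p.2) q := by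
  simp [Matrix.mul_apply, kronId, Fintype.sum_prod_type]

theorem rightAnsatz_kronId_mul {K m n : ℕ} {A : Fin (K + 2) → Matrix (Fin m) (Fin n) F}
    {X Y : Matrix (Fin (K + 1) × Fin m) (Fin (K + 1) × Fin n) F} {v : Fin (K + 1) → F}
    (h : RightAnsatz (matPoly A) (pencil X Y) v) (M : Matrix (Fin (K + 1)) (Fin (K + 1)) F) :
    RightAnsatz (matPoly A) (pencil (kronId (m := m) M * X) (kronId (m := m) M * Y)) (M.mulVec v) := by
  rw [rightAnsatz_iff] at h ⊢
  intro p c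
  simp only [kronId_mul_apply, Matrix.mulVec, dotProduct, Finset.sum_mul, mul_assoc,
    ← Finset.sum_add_distrib, ← mul_add, (h _ c).1, (h _ c).2.1, (h _ c).2.2, implies_true,
    and_self]

theorem isUnit_kronId {k m : ℕ} {M : Matrix (Fin k) (Fin k) F} (hM : IsUnit M) :
    IsUnit (kronId M : Matrix (Fin k × Fin m) (Fin k × Fin m) F) := by
  have : (kronId M : Matrix (Fin k × Fin m) (Fin k × Fin m) F) =
      Matrix.kroneckerMap (· * ·) M (1 : Matrix (Fin m) (Fin m) F) := by
    ext1 p q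
    simp [kronId, Matrix.kroneckerMap_apply, Matrix.one_apply]
  rw [this, Matrix.isUnit_iff_isUnit_det, Matrix.det_kronecker]
  rw [Matrix.isUnit_iff_isUnit_det] at hM
  simpa using hM.pow _

/-- The unimodular matrix `(I - λN) ⊗ I_n` with `N` the nilpotent shift. -/
def shiftFactor (F : Type*) [RCLike F] (K n : ℕ) :
    Matrix (Fin (K + 1) × Fin n) (Fin (K + 1) × Fin n) F[X] :=
  Matrix.kroneckerMap (· * ·)
    (Matrix.of fun i j : Fin (K + 1) =>
      (if i = j then 1 else 0) - (if (j : ℕ) = i + 1 then Polynomial.X else 0))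
    (1 : Matrix (Fin n) (Fin n) F[X])

theorem isUnit_shiftFactor (K n : ℕ) : IsUnit (shiftFactor F K n) := by
  rw [Matrix.isUnit_iff_isUnit_det, shiftFactor, Matrix.det_kronecker,
    Matrix.det_of_isUpperTriangular]
  · simp
  · intro i j hij
    have : (j : ℕ) < i := hij
    simp only [Matrix.of_apply]
    rw [if_neg (by omega), if_neg (by omega), sub_zero]

theorem shiftFactor_mul_Lam (K n : ℕ) :
    shiftFactor F K n * Lam F (K + 1) n =
      Matrix.of fun p c => if p = (Fin.last K, c) then 1 else 0 := by
  ext1 ⟨i, a⟩ c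
  simp only [shiftFactor, Lam, Matrix.mul_apply, Fintype.sum_prod_type, Matrix.kroneckerMap_apply,
    Matrix.one_apply, Matrix.of_apply]
  refine Fin.lastCases ?_ (fun i => ?_) i
  · have h : ∀ j : Fin (K + 1), (j : ℕ) ≠ K + 1 := fun j => j.isLt.ne
    simp [h]
  · have h : ∀ j : Fin (K + 1), (j : ℕ) = i + 1 ↔ i.succ = j := fun j => by
      rw [Fin.ext_iff, eq_comm, Fin.val_succ]
    have hpow : (Polynomial.X : F[X]) ^ (K - (i : ℕ)) =
        Polynomial.X * Polynomial.X ^ (K - ((i : ℕ) + 1)) := by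
      rw [← pow_succ']
      congr 1
      omega
    simp [sub_mul, Finset.sum_sub_distrib, h, hpow]

theorem mul_shiftFactor_apply {ρ : Type*} {K n : ℕ}
    (B : Matrix ρ (Fin (K + 1) × Fin n) F[X]) (p : ρ) (j : Fin (K + 1)) (b : Fin n) :
    (B * shiftFactor F K n) p (j, b) =
      B p (j, b) - Fin.cases 0 (fun i : Fin K => B p (i.castSucc, b) * Polynomial.X) j := by
  simp only [shiftFactor, Matrix.mul_apply, Fintype.sum_prod_type, Matrix.kroneckerMap_apply,
    Matrix.one_apply, Matrix.of_apply]
  refine Fin.cases ?_ (fun i => ?_) j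
  · simp
  · have h : ∀ j : Fin (K + 1), (i : ℕ) = j ↔ j = i.castSucc := fun j => by
      rw [Fin.ext_iff, eq_comm, Fin.val_castSucc]
    simp [mul_sub, Finset.sum_sub_distrib, h]

theorem isGLin_of_kronId_mul {k m n : ℕ} {P : Matrix (Fin m) (Fin n) F[X]}
    {X Y : Matrix (Fin k × Fin m) (Fin k × Fin n) F} {M : Matrix (Fin k) (Fin k) F}
    (hM : IsUnit M) (h : IsGLin P (pencil (kronId (m := m) M * X) (kronId (m := m) M * Y))) :
    IsGLin P (pencil X Y) := by
  obtain ⟨E, G, hE, hG, h⟩ := h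
  refine ⟨E * (kronId M).map Polynomial.C, G, ?_, hG, ?_⟩
  · rw [Matrix.det_mul]
    refine hE.mul ?_
    have := ((Matrix.isUnit_iff_isUnit_det _).1 (isUnit_kronId (m := m) hM)).map
      (Polynomial.C : F →+* F[X])
    rwa [RingHom.map_det] at this
  · rw [Matrix.mul_assoc E, map_C_mul_pencil, h]

/-- A pencil whose right ansatz vector is `α e₁` is a g-linearization as soon as the lower left
block of its constant coefficient has full column rank. -/
theorem isGLin_of_rightAnsatz_e1 {K m n : ℕ} (hmn : n ≤ m)
    {A : Fin (K + 2) → Matrix (Fin m) (Fin n) F}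
    {X Y : Matrix (Fin (K + 1) × Fin m) (Fin (K + 1) × Fin n) F} {α : F} (hα : α ≠ 0)
    (hL : RightAnsatz (matPoly A) (pencil X Y) (e1 α))
    (hZ : (Matrix.of fun (p : Fin K × Fin m) (q : Fin K × Fin n) =>
      Y (p.1.succ, p.2) (q.1.castSucc, q.2)).rank = K * n) :
    IsGLin (matPoly A) (pencil X Y) := by
  set Z := Matrix.of fun (p : Fin K × Fin m) (q : Fin K × Fin n) =>
      Y (p.1.succ, p.2) (q.1.castSucc, q.2) with hZdef
  have hS := (Matrix.isUnit_iff_isUnit_det _).1 (isUnit_shiftFactor (F := F) K n)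
  set S := shiftFactor F K n with hSdef
  have hcoeff := (rightAnsatz_iff A X Y (e1 α)).1 hL
  -- the last block column of `L S⁻¹`
  have hlast : ∀ p c, (pencil X Y * S⁻¹) p (Fin.last K, c) =
      Polynomial.C (e1 α p.1) * matPoly A p.2 c := fun p c => by
    have : pencil X Y * S⁻¹ * (S * Lam F (K + 1) n) = vkron (e1 α) (matPoly A) := by
      rw [Matrix.mul_assoc, Matrix.nonsing_inv_mul_cancel_left _ _ hS]
      exact hL
    rw [hSdef, shiftFactor_mul_Lam] at this
    simpa [Matrix.mul_apply, vkron] using congrFun (congrFun this p) c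
  -- the lower block rows of `L S⁻¹`
  have hbot : ∀ (p : Fin K × Fin m) (q : Fin K × Fin n),
      (pencil X Y * S⁻¹) (p.1.succ, p.2) (q.1.castSucc, q.2) = Polynomial.C (Z p q) := by
    let B : Matrix (Fin K × Fin m) (Fin (K + 1) × Fin n) F[X] := Matrix.of fun p q =>
      Fin.lastCases 0 (fun j => Polynomial.C (Z p (j, q.2))) q.1
    have hB : B * S = (pencil X Y).submatrix (fun p : Fin K × Fin m => (p.1.succ, p.2)) id := by
      ext1 p ⟨j, b⟩
      have h := hcoeff (p.1.succ, p.2) b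
      simp only [e1, Fin.val_succ, Nat.succ_ne_zero, if_false, zero_mul] at h
      rw [hSdef, mul_shiftFactor_apply]
      have hX : ∀ i : Fin K, X (p.1.succ, p.2) (i.succ, b) = -Z p (i, b) := fun i =>
        eq_neg_of_add_eq_zero_right (h.2.2 i)
      have hcol : B p (j, b) = Polynomial.C (Y (p.1.succ, p.2) (j, b)) := by
        refine Fin.lastCases ?_ (fun i => ?_) j
        · simp [B, h.2.1]
        · simp [B, Z]
      rw [hcol]
      refine Fin.cases ?_ (fun i => ?_) j
      · simp [pencil, h.1]
      · simp [pencil, hX, B, sub_eq_neg_add]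
    have hB' : B = (pencil X Y * S⁻¹).submatrix (fun p : Fin K × Fin m => (p.1.succ, p.2)) id := by
      rw [← Matrix.mul_nonsing_inv_cancel_right _ B hS, hB]
      rfl
    intro p q
    have := congrFun (congrFun hB' p) (q.1.castSucc, q.2)
    simpa [B] using this.symm
  have hblocks : (pencil X Y * S⁻¹).submatrix (firstBlock K m) (lastBlock K n) =
      Matrix.fromBlocks (Polynomial.C α • matPoly A)
        (Matrix.of fun a q => (pencil X Y * S⁻¹) (0, a) (q.1.castSucc, q.2)) 0
        (Z.map Polynomial.C) := by
    ext1 p q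
    rcases p with a | p <;> rcases q with b | q
    · simp [firstBlock, lastBlock, hlast, e1]
    · simp [firstBlock, lastBlock]
    · simp [firstBlock, lastBlock, hlast, e1]
    · simp [firstBlock, lastBlock, hbot]
  obtain ⟨E, hE, hEeq⟩ := exists_isUnit_mul_fromBlocks (matPoly A)
    (Matrix.of fun a q => (pencil X Y * S⁻¹) (0, a) (q.1.castSucc, q.2)) hα
    (mulVec_injective_of_rank_eq (Z := Z) (by simpa using hZ))
    (eyeBlocks_mulVec_injective (F := F) (K := K) hmn)
  refine isGLin_of_blocks (lastBlock K n) hE (G := S⁻¹.submatrix (lastBlock K n) (lastBlock K n))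
    ?_ ?_
  · rw [Matrix.isUnit_submatrix_equiv, Matrix.isUnit_nonsing_inv_iff]
    exact isUnit_shiftFactor K n
  · rw [Matrix.mul_assoc, Matrix.submatrix_mul_equiv, hblocks, hEeq]

/-! ### Reversal -/

theorem revMat_one_pencil {ρ γ : Type*} (X Y : Matrix ρ γ F) :
    revMat 1 (pencil X Y) = pencil Y X := by
  ext1 i j
  have h0 := Polynomial.reflect_C_mul_X_pow 1 0 (c := Y i j)
  have h1 := Polynomial.reflect_C_mul_X_pow 1 1 (c := X i j)
  rw [Polynomial.revAt_le (by simp)] at h0 h1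
  simp only [pow_zero, mul_one, pow_one, Nat.sub_zero, Nat.sub_self] at h0 h1
  simp [revMat, pencil, Polynomial.reflect_add, h0, h1, add_comm]

theorem revMat_matPoly {k m n : ℕ} (A : Fin (k + 1) → Matrix (Fin m) (Fin n) F) :
    revMat k (matPoly A) = matPoly fun i => A i.rev := by
  ext1 r c
  have hsum : ∀ s : Finset (Fin (k + 1)),
      Polynomial.reflect k (∑ i ∈ s, Polynomial.C (A i r c) * Polynomial.X ^ (i : ℕ)) =
        ∑ i ∈ s, Polynomial.C (A i r c) * Polynomial.X ^ (k - (i : ℕ)) := fun s => by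
    induction s using Finset.induction_on with
    | empty => simp
    | insert i s hi ih =>
      rw [Finset.sum_insert hi, Finset.sum_insert hi, Polynomial.reflect_add, ih,
        Polynomial.reflect_C_mul_X_pow, Polynomial.revAt_le (Nat.le_of_lt_succ i.isLt)]
  simp only [revMat, matPoly, Matrix.map_apply, Matrix.of_apply, hsum]
  rw [← Equiv.sum_comp Fin.revPerm]
  refine Finset.sum_congr rfl fun i _ => ?_
  rw [Fin.revPerm_apply, Fin.val_rev]
  congr 2
  omega

/-- Reversal of the order of the blocks. -/
def revBlocks (K n : ℕ) : Fin K × Fin n ≃ Fin K × Fin n :=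
  Equiv.prodCongr Fin.revPerm (Equiv.refl _)

theorem rightAnsatz_rev {K m n : ℕ} {A : Fin (K + 2) → Matrix (Fin m) (Fin n) F}
    {X Y : Matrix (Fin (K + 1) × Fin m) (Fin (K + 1) × Fin n) F} {v : Fin (K + 1) → F}
    (h : RightAnsatz (matPoly A) (pencil X Y) v) :
    RightAnsatz (matPoly fun i => A i.rev)
      (pencil (Y.submatrix id (revBlocks (K + 1) n)) (X.submatrix id (revBlocks (K + 1) n))) v := by
  rw [rightAnsatz_iff] at h ⊢
  intro p c
  obtain ⟨hX, hY, hXY⟩ := h p c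
  refine ⟨by simpa [revBlocks] using hY, by simpa [revBlocks] using hX, fun j => ?_⟩
  have := hXY j.rev
  simp only [revBlocks, Matrix.submatrix_apply, id, Equiv.prodCongr_apply, Prod.map,
    Fin.revPerm_apply, Equiv.refl_apply, Fin.rev_castSucc, Fin.rev_succ, Fin.rev_rev] at this ⊢
  rw [add_comm, this, Fin.succ_castSucc]

theorem isGLin_of_submatrix {k m n : ℕ} {P : Matrix (Fin m) (Fin n) F[X]}
    {L : Matrix (Fin k × Fin m) (Fin k × Fin n) F[X]} (e : Fin k × Fin n ≃ Fin k × Fin n)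
    (h : IsGLin P (L.submatrix id e)) : IsGLin P L := by
  obtain ⟨E, G, hE, hG, h⟩ := h
  refine ⟨E, G.submatrix e.symm id, hE, ?_, ?_⟩
  · rw [← Matrix.isUnit_iff_isUnit_det] at hG ⊢
    exact (Matrix.isUnit_submatrix_equiv e.symm (Equiv.refl _)).2 hG
  · have hL : L = (L.submatrix id e).submatrix id e.symm := by simp
    rw [hL, Matrix.mul_assoc, Matrix.submatrix_mul_equiv, Matrix.submatrix_id_id,
      ← Matrix.mul_assoc, h]

/-- For `m ≥ n` and `L(λ) = λX + Y ∈ 𝕃₁(P)` with nonzero right ansatz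
vector `v`: for any nonsingular `M` with `Mv = α e₁` (`α ≠ 0`), the pencil `(M ⊗ I_m) L(λ)`
has the block form `λ[[αA_k, X₁₂],[0, −Z]] + [[Y₁₁, αA₀],[Z, 0]]`; and if
`rank Z = (k−1)n` then `L(λ)` is a strong g-linearization of `P(λ)`. -/
theorem statement_2 {F : Type*} [RCLike F] {k m n : ℕ} (hk : 0 < k) (hmn : n ≤ m)
    (A : Fin (k + 1) → Matrix (Fin m) (Fin n) F)
    (Xc Yc : Matrix (Fin k × Fin m) (Fin k × Fin n) F)
    (v : Fin k → F) (hv : v ≠ 0)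
    (hL : RightAnsatz (matPoly A) (pencil Xc Yc) v)
    (M : Matrix (Fin k) (Fin k) F) (hM : IsUnit M)
    (α : F) (hα : α ≠ 0) (hMv : M.mulVec v = e1 α) :
    (∃ (X12 Y11 : Matrix (Fin m) (Fin (k - 1) × Fin n) F),
      kronId M * Xc = blk (α • A (Fin.last k)) X12 0 (-(Zmat1 M Yc)) ∧
      kronId M * Yc = blkY1 Y11 (α • A 0) (Zmat1 M Yc)) ∧
    ((Zmat1 M Yc).rank = (k - 1) * n → IsStrongGLin A (pencil Xc Yc)) := by
  obtain ⟨K, rfl⟩ : ∃ K, k = K + 1 := ⟨k - 1, by omega⟩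
  have hNL := rightAnsatz_kronId_mul hL M
  rw [hMv] at hNL
  have hcoeff := (rightAnsatz_iff _ _ _ _).1 hNL
  have hbot : ∀ (p : Fin K × Fin m) (q : Fin K × Fin n),
      (kronId (m := m) M * Xc) (p.1.succ, p.2) (q.1.succ, q.2) = -Zmat1 M Yc p q := fun p q => by
    have h := (hcoeff (p.1.succ, p.2) q.2).2.2 q.1
    simp only [e1, Fin.val_succ, Nat.succ_ne_zero, if_false, zero_mul] at h
    exact eq_neg_of_add_eq_zero_right h
  refine ⟨⟨Matrix.of fun a q => (kronId (m := m) M * Xc) (0, a) (Fin.succ q.1, q.2),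
    Matrix.of fun a q => (kronId (m := m) M * Yc) (0, a) (Fin.castSucc q.1, q.2), ?_, ?_⟩,
    fun hZ => ⟨?_, ?_⟩⟩
  · change kronId (m := m) M * Xc = _
    ext1 ⟨i, a⟩ ⟨j, b⟩
    refine Fin.cases ?_ (fun i => ?_) i <;> refine Fin.cases ?_ (fun j => ?_) j
    · simpa [blk, e1] using (hcoeff (0, a) b).1
    · rfl
    · simpa [blk, e1] using (hcoeff (i.succ, a) b).1
    · exact hbot (i, a) (j, b)
  · change kronId (m := m) M * Yc = _
    ext1 ⟨i, a⟩ ⟨j, b⟩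
    refine Fin.cases ?_ (fun i => ?_) i <;> refine Fin.lastCases ?_ (fun j => ?_) j
    · simpa [blkY1, e1] using (hcoeff (0, a) b).2.1
    · simp [blkY1]
    · simpa [blkY1, e1] using (hcoeff (i.succ, a) b).2.1
    · simp [blkY1, Zmat1]
      rfl
  · exact isGLin_of_kronId_mul hM (isGLin_of_rightAnsatz_e1 hmn hα hNL hZ)
  · rw [revMat_one_pencil, revMat_matPoly]
    have hrev := rightAnsatz_kronId_mul (rightAnsatz_rev hL) M
    rw [hMv] at hrev
    refine isGLin_of_submatrix (revBlocks (K + 1) n)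
      (isGLin_of_kronId_mul (X := Yc.submatrix id (revBlocks (K + 1) n))
        (Y := Xc.submatrix id (revBlocks (K + 1) n)) hM
        (isGLin_of_rightAnsatz_e1 hmn hα hrev ?_))
    have hZrev : (Matrix.of fun (p : Fin K × Fin m) (q : Fin K × Fin n) =>
        (kronId (m := m) M * Xc.submatrix id (revBlocks (K + 1) n))
          (p.1.succ, p.2) (q.1.castSucc, q.2)) =
        (-1 : F) • (Zmat1 M Yc).submatrix (Equiv.refl (Fin K × Fin m)) (revBlocks K n) := by
      ext1 p q
      have h := hbot p (revBlocks K n q)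
      simp only [revBlocks, Equiv.prodCongr_apply, Prod.map, Fin.revPerm_apply, Equiv.refl_apply,
        ← Fin.rev_castSucc] at h
      rw [neg_one_smul]
      exact h
    rw [hZrev, Matrix.rank_smul_of_mem_nonZeroDivisors _
      (mem_nonZeroDivisors_of_ne_zero (neg_ne_zero.2 one_ne_zero))]
    exact (Matrix.rank_submatrix _ _ _).trans hZ
end GLin
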